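/- Suppose the collection 𝒫_A^⊆ of potential-outcome distributions obeys distributional consistency and 𝒫_A obeys the SWIG ordered local Markov property for the DAG 𝒢 under ≺. Let B ⊆ A and b ∈ 𝔛_B. Then for every i ∈ V and every v ∈ 𝔛_V such that p(X_{pre(i)}(b) = v_{pre(i)}) > 0 and p(X_{pa(i)∩B} = b_{pa(i)∩B}, X_{pa(i)∖B} = v_{pa(i)∖B}) > 0: p(X_i(b) = v_i | X_{pre(i)}(b) = v_{pre(i)}) = p(X_i = v_i | X_{pa(i)∩B} = b_{pa(i)∩B}, X_{pa(i)∖B} = v_{pa(i)∖B}). Consequently p(V(b)) is identified from p(V) whenever all the observed conditional distributions on the right are well-defined. -/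

import Mathlib

open Finset

namespace CausalPaper

variable {V : Type*} [Fintype V] [LinearOrder V]
variable {𝔛 : V → Type*} [∀ i, Fintype (𝔛 i)]

/-- Probability of the event `E` under the distribution `q` on joint assignments. -/
noncomputable def pr (q : (∀ i, 𝔛 i) → ℝ) (E : (∀ i, 𝔛 i) → Prop) : ℝ :=
  ∑ v : (∀ i, 𝔛 i), Set.indicator (setOf E) q v

/-- Conditional probability of `E` given `F` under `q`. -/
noncomputable def cpr (q : (∀ i, 𝔛 i) → ℝ) (E F : (∀ i, 𝔛 i) → Prop) : ℝ :=
  pr q (fun v => E v ∧ F v) / pr q F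

/-- `q` is a probability distribution on joint assignments. -/
def IsProb (q : (∀ i, 𝔛 i) → ℝ) : Prop :=
  (∀ v, 0 ≤ q v) ∧ (∑ v : (∀ i, 𝔛 i), q v) = 1

/-- `v` agrees with `s` on the coordinates in `S`. -/
def agree (S : Finset V) (s v : ∀ i, 𝔛 i) : Prop :=
  ∀ i ∈ S, v i = s i

/-- The intervention/regime that sets the variables in `B` according to `b`
(and is idle elsewhere). -/
def setOn (B : Finset V) (b : ∀ i, 𝔛 i) : ∀ i, Option (𝔛 i) :=
  fun i => if i ∈ B then some (b i) else none

/-- The support of the partial intervention/regime `f` is contained in `A`. -/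
def suppIn (f : ∀ i, Option (𝔛 i)) (A : Finset V) : Prop :=
  ∀ i, f i ≠ none → i ∈ A

/-- Distributional consistency. -/
def DistConsistent (A : Finset V) (P : (∀ i, Option (𝔛 i)) → (∀ i, 𝔛 i) → ℝ) : Prop :=
  ∀ i ∈ A, ∀ C : Finset V, C ⊆ A \ {i} →
    ∀ (y : ∀ j, 𝔛 j) (b : 𝔛 i) (c : ∀ j, 𝔛 j),
      pr (P (Function.update (setOn C c) i (some b)))
          (fun v => agree (univ \ {i}) y v ∧ v i = b)
        = pr (P (setOn C c)) (fun v => agree (univ \ {i}) y v ∧ v i = b)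

/-- The predecessors of `i` under the total order on `V`. -/
def pre (i : V) : Finset V := univ.filter (fun j => j < i)

/-- The (SWIG / augmented-DAG) ordered local Markov property: under the regime
intervening on all of `A`, the conditional distribution of `X_i` given its
predecessors is a function only of `a` on `pa i ∩ A` and of `w` on `pa i \ A`. -/
def SWIGLocalMarkov (A : Finset V) (pa : V → Finset V)
    (P : (∀ i, Option (𝔛 i)) → (∀ i, 𝔛 i) → ℝ) : Prop :=
  ∀ (i : V) (a a' w w' : ∀ j, 𝔛 j) (x : 𝔛 i),
    0 < pr (P (setOn A a)) (agree (pre i) w) →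
    0 < pr (P (setOn A a')) (agree (pre i) w') →
    (∀ j ∈ pa i ∩ A, a j = a' j) →
    (∀ j ∈ pa i \ A, w j = w' j) →
    cpr (P (setOn A a)) (fun v => v i = x) (agree (pre i) w)
      = cpr (P (setOn A a')) (fun v => v i = x) (agree (pre i) w')

/-- The ordinary ordered local Markov property for a single distribution `q`:
the conditional distribution of `X_i` given its predecessors is a function only
of the values of the parents. -/
def OrderedLocalMarkov (pa : V → Finset V) (q : (∀ i, 𝔛 i) → ℝ) : Prop :=
  ∀ (i : V) (w w' : ∀ j, 𝔛 j) (x : 𝔛 i),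
    0 < pr q (agree (pre i) w) →
    0 < pr q (agree (pre i) w') →
    (∀ j ∈ pa i, w j = w' j) →
    cpr q (fun v => v i = x) (agree (pre i) w)
      = cpr q (fun v => v i = x) (agree (pre i) w')

section Probability

lemma pr_congr (q : (∀ i, 𝔛 i) → ℝ) {E F : (∀ i, 𝔛 i) → Prop} (h : ∀ u, E u ↔ F u) :
    pr q E = pr q F := by
  rw [funext fun u => propext (h u)]

lemma pr_nonneg {q : (∀ i, 𝔛 i) → ℝ} (hq : ∀ u, 0 ≤ q u) (E : (∀ i, 𝔛 i) → Prop) :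
    0 ≤ pr q E :=
  Finset.sum_nonneg fun _ _ => Set.indicator_nonneg (fun u _ => hq u) _

lemma pr_mono {q : (∀ i, 𝔛 i) → ℝ} (hq : ∀ u, 0 ≤ q u) {E F : (∀ i, 𝔛 i) → Prop}
    (h : ∀ u, E u → F u) : pr q E ≤ pr q F :=
  Finset.sum_le_sum fun u _ => Set.indicator_le_indicator_of_subset (fun u hu => h u hu) hq u

open Classical in
lemma pr_eq_sum_ite (q : (∀ i, 𝔛 i) → ℝ) (E : (∀ i, 𝔛 i) → Prop) :
    pr q E = ∑ u, if E u then q u else 0 :=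
  Finset.sum_congr rfl fun _ _ => Set.indicator_apply _ _ _

lemma pr_false (q : (∀ i, 𝔛 i) → ℝ) {E : (∀ i, 𝔛 i) → Prop} (h : ∀ u, ¬ E u) :
    pr q E = 0 :=
  Finset.sum_eq_zero fun u _ => Set.indicator_of_notMem (h u) q

lemma pr_eq_sum_fiber {R : Type*} [Fintype R] (q : (∀ i, 𝔛 i) → ℝ) (E : (∀ i, 𝔛 i) → Prop)
    (f : (∀ i, 𝔛 i) → R) : pr q E = ∑ r, pr q (fun u => E u ∧ f u = r) := by
  classical
  simp_rw [pr_eq_sum_ite]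
  rw [Finset.sum_comm]
  refine Finset.sum_congr rfl fun u _ => ?_
  by_cases hu : E u <;> simp [hu]

lemma pr_agree_univ (q : (∀ i, 𝔛 i) → ℝ) (v : ∀ i, 𝔛 i) : pr q (agree univ v) = q v := by
  classical
  have h : ∀ u, agree univ v u ↔ u = v := fun u => by simp [agree, funext_iff]
  simp [pr_eq_sum_ite, h]

lemma pr_agree_empty {q : (∀ i, 𝔛 i) → ℝ} (hq : IsProb q) (v : ∀ i, 𝔛 i) :
    pr q (agree ∅ v) = 1 := by
  simpa [pr_eq_sum_ite, agree] using hq.2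

omit [Fintype V] [∀ i, Fintype (𝔛 i)] in
lemma agree_insert_iff (i : V) (S : Finset V) (v u : ∀ i, 𝔛 i) :
    agree (insert i S) v u ↔ u i = v i ∧ agree S v u := by
  simp [agree]

omit [Fintype V] [∀ i, Fintype (𝔛 i)] in
lemma agree_update_iff {i : V} {S : Finset V} (hi : i ∉ S) (v : ∀ i, 𝔛 i) (x : 𝔛 i)
    (u : ∀ i, 𝔛 i) : agree S (Function.update v i x) u ↔ agree S v u := by
  refine forall₂_congr fun j hj => ?_
  rw [Function.update_of_ne (ne_of_mem_of_not_mem hj hi)]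

omit [Fintype V] [∀ i, Fintype (𝔛 i)] in
lemma agree_insert_update_iff {i : V} {S : Finset V} (hi : i ∉ S) (v : ∀ i, 𝔛 i) (x : 𝔛 i)
    (u : ∀ i, 𝔛 i) :
    agree (insert i S) (Function.update v i x) u ↔ u i = x ∧ agree S v u := by
  rw [agree_insert_iff, agree_update_iff hi, Function.update_self]

lemma pr_and_eq_cpr_mul {q : (∀ i, 𝔛 i) → ℝ} (hq : ∀ u, 0 ≤ q u)
    (E F : (∀ i, 𝔛 i) → Prop) : pr q (fun u => E u ∧ F u) = cpr q E F * pr q F := by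
  by_cases h : pr q F = 0
  · rw [h, mul_zero]
    exact le_antisymm (h ▸ pr_mono hq fun u hu => hu.2) (pr_nonneg hq _)
  · rw [cpr, div_mul_cancel₀ _ h]

/-- If the conditional probability of `E` is constant on the atoms of the `S`-coordinates that
make up `F`, then it is also the conditional probability given `F`. -/
lemma pr_and_eq_mul_of_fiberwise (q : (∀ i, 𝔛 i) → ℝ) (E F : (∀ i, 𝔛 i) → Prop) (S : Finset V)
    (K : ℝ) (hF : ∀ u w, agree S w u → (F u ↔ F w))
    (h : ∀ w, F w → pr q (fun u => E u ∧ agree S w u) = K * pr q (agree S w)) :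
    pr q (fun u => E u ∧ F u) = K * pr q F := by
  let f : (∀ i, 𝔛 i) → (∀ i : S, 𝔛 i) := fun u i => u i
  rw [pr_eq_sum_fiber q _ f, pr_eq_sum_fiber q F f, Finset.mul_sum]
  refine Finset.sum_congr rfl fun r _ => ?_
  by_cases hr : ∃ w, F w ∧ f w = r
  · obtain ⟨w, hw, rfl⟩ := hr
    have hag : ∀ u, f u = f w ↔ agree S w u := fun u => by simp [f, funext_iff, agree]
    have hFw : ∀ u, F u ∧ f u = f w ↔ agree S w u := fun u => by
      rw [hag]
      exact ⟨And.right, fun hu => ⟨(hF u w hu).2 hw, hu⟩⟩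
    rw [pr_congr q hFw, ← h w hw]
    exact pr_congr q fun u => by rw [and_assoc, hFw]
  · rw [pr_false q fun u hu => hr ⟨u, hu.1.2, hu.2⟩, pr_false q fun u hu => hr ⟨u, hu⟩, mul_zero]

end Probability

section Order

lemma notMem_pre (i : V) : i ∉ pre i := by simp [pre]

lemma isLowerSet_pre (i : V) : IsLowerSet (pre i : Set V) := by
  intro j k hkj hj
  simp only [pre, mem_coe, mem_filter, mem_univ, true_and] at hj ⊢
  exact hkj.trans_lt hj

lemma isLowerSet_insert_pre (i : V) : IsLowerSet ((insert i (pre i) : Finset V) : Set V) := by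
  intro j k hkj hj
  simp only [pre, mem_coe, mem_insert, mem_filter, mem_univ, true_and] at hj ⊢
  exact le_iff_eq_or_lt.1 (hkj.trans (le_iff_eq_or_lt.2 hj))

/-- Induction over the initial segments of `V`, adding one element at a time. -/
lemma lowerSet_induction {p : ∀ S : Finset V, IsLowerSet (S : Set V) → Prop}
    (empty : p ∅ (by simpa using isLowerSet_empty))
    (insert : ∀ i, p (pre i) (isLowerSet_pre i) → p (insert i (pre i)) (isLowerSet_insert_pre i))
    (S : Finset V) (hS : IsLowerSet (S : Set V)) : p S hS := by
  induction S using Finset.induction_on_max with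
  | empty => exact empty
  | insert m S hm ih =>
    have hpre : S = pre m := by
      ext j
      simp only [pre, mem_filter, mem_univ, true_and]
      refine ⟨hm j, fun hj => ?_⟩
      have := hS hj.le (by simp)
      simp only [coe_insert, Set.mem_insert_iff, hj.ne, false_or, mem_coe] at this
      exact this
    subst hpre
    exact insert m (ih (isLowerSet_pre m))

/-- Induction over the initial segments of `V`, removing one element at a time. -/
lemma lowerSet_reverse_induction {p : ∀ S : Finset V, IsLowerSet (S : Set V) → Prop}
    (univ : p univ (by simpa using isLowerSet_univ))
    (remove : ∀ i, p (insert i (pre i)) (isLowerSet_insert_pre i) → p (pre i) (isLowerSet_pre i))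
    (S : Finset V) (hS : IsLowerSet (S : Set V)) : p S hS := by
  induction hn : Sᶜ.card generalizing S with
  | zero =>
    rw [card_eq_zero, compl_eq_empty_iff] at hn
    subst hn
    exact univ
  | succ n ih =>
    have hne : Sᶜ.Nonempty := card_pos.1 (by omega)
    set m := Sᶜ.min' hne
    have hm : m ∉ S := mem_compl.1 (Sᶜ.min'_mem hne)
    have hpre : S = pre m := by
      ext j
      simp only [pre, mem_filter, mem_univ, true_and]
      refine ⟨fun hj => lt_of_not_ge fun hmj => hm (hS hmj hj), fun hj => ?_⟩
      by_contra hjS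
      exact (Sᶜ.min'_le j (mem_compl.2 hjS)).not_gt hj
    have hcard : (Insert.insert m S)ᶜ.card = n := by
      rw [compl_insert, card_erase_of_mem (mem_compl.2 hm), hn, Nat.add_sub_cancel]
    clear_value m
    subst hpre
    exact remove m (ih _ (isLowerSet_insert_pre m) hcard)

end Order

section Interventions

omit [Fintype V] [∀ i, Fintype (𝔛 i)] in
lemma suppIn_setOn {A B : Finset V} (hBA : B ⊆ A) (b : ∀ j, 𝔛 j) : suppIn (setOn B b) A := by
  intro i hi
  by_contra h
  exact hi (if_neg fun hB => h (hBA hB))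

omit [Fintype V] [∀ i, Fintype (𝔛 i)] in
lemma setOn_empty (b : ∀ j, 𝔛 j) : setOn ∅ b = fun _ => none := by
  funext i
  simp [setOn]

omit [Fintype V] [∀ i, Fintype (𝔛 i)] in
lemma setOn_insert (i : V) (C : Finset V) (c : ∀ j, 𝔛 j) :
    setOn (insert i C) c = Function.update (setOn C c) i (some (c i)) := by
  funext j
  by_cases h : j = i
  · subst h
    simp [setOn]
  · simp [setOn, h]

omit [Fintype V] [∀ i, Fintype (𝔛 i)] in
lemma setOn_congr {C : Finset V} {c c' : ∀ j, 𝔛 j} (h : ∀ j ∈ C, c j = c' j) :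
    setOn C c = setOn C c' := by
  funext j
  by_cases hj : j ∈ C
  · simp [setOn, hj, h j hj]
  · simp [setOn, hj]

variable {A : Finset V} {pa : V → Finset V} {P : (∀ i, Option (𝔛 i)) → (∀ i, 𝔛 i) → ℝ}

lemma DistConsistent.apply_update (hDC : DistConsistent A P) {i : V} (hi : i ∈ A)
    {C : Finset V} (hC : C ⊆ A \ {i}) (c v : ∀ j, 𝔛 j) :
    P (Function.update (setOn C c) i (some (v i))) v = P (setOn C c) v := by
  have h := hDC i hi C hC v (v i) c
  have hiff : ∀ u, (agree (univ \ {i}) v u ∧ u i = v i) ↔ agree univ v u := fun u => by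
    refine ⟨fun hu j _ => ?_, fun hu => ⟨fun j _ => hu j (mem_univ j), hu i (mem_univ i)⟩⟩
    by_cases hj : j = i
    · subst hj
      exact hu.2
    · exact hu.1 j (by simp [hj])
  rwa [pr_congr _ hiff, pr_congr _ hiff, pr_agree_univ, pr_agree_univ] at h

/-- Intervening additionally on variables at their realized values does not change the
probability of an outcome. -/
lemma DistConsistent.apply_eq_apply_setOn_piecewise (hDC : DistConsistent A P) {B : Finset V}
    (hBA : B ⊆ A) (b v : ∀ j, 𝔛 j) :
    P (setOn B b) v = P (setOn A (B.piecewise b v)) v := by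
  have key : ∀ T : Finset V, T ⊆ A \ B →
      P (setOn (T ∪ B) (B.piecewise b v)) v = P (setOn B b) v := by
    intro T
    induction T using Finset.induction_on with
    | empty =>
      intro _
      rw [empty_union, setOn_congr fun j hj => B.piecewise_eq_of_mem b v hj]
    | insert i T hi ih =>
      intro hT
      obtain ⟨hiA, hiB⟩ := mem_sdiff.1 (hT (mem_insert_self i T))
      have hT' : T ⊆ A \ B := (subset_insert i T).trans hT
      have hsub : T ∪ B ⊆ A \ {i} := by
        intro j hj
        rw [mem_sdiff, mem_singleton]
        rcases mem_union.1 hj with hj | hj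
        · exact ⟨(mem_sdiff.1 (hT' hj)).1, fun h => hi (h ▸ hj)⟩
        · exact ⟨hBA hj, fun h => hiB (h ▸ hj)⟩
      rw [insert_union, setOn_insert, B.piecewise_eq_of_notMem b v hiB,
        hDC.apply_update hiA hsub, ih hT']
  rw [← key (A \ B) subset_rfl, sdiff_union_of_subset hBA]

lemma SWIGLocalMarkov.pr_and_congr (hpa : ∀ i, pa i ⊆ pre i)
    (hP : ∀ f, suppIn f A → IsProb (P f)) (hM : SWIGLocalMarkov A pa P) (i : V)
    {a a' : ∀ j, 𝔛 j} (w : ∀ j, 𝔛 j) (x : 𝔛 i) (ha : ∀ j ∈ pre i, a j = a' j)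
    (h : pr (P (setOn A a)) (agree (pre i) w) = pr (P (setOn A a')) (agree (pre i) w)) :
    pr (P (setOn A a)) (fun u => u i = x ∧ agree (pre i) w u)
      = pr (P (setOn A a')) (fun u => u i = x ∧ agree (pre i) w u) := by
  have hq := fun c => (hP (setOn A c) (suppIn_setOn subset_rfl c)).1
  rw [pr_and_eq_cpr_mul (hq a), pr_and_eq_cpr_mul (hq a'), ← h]
  rcases (pr_nonneg (hq a) (agree (pre i) w)).eq_or_lt with h0 | h0
  · rw [← h0, mul_zero, mul_zero]
  · rw [hM i a a' w w x h0 (h ▸ h0) (fun j hj => ha j (hpa i (mem_inter.1 hj).1))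
      fun _ _ => rfl]

/-- The distribution of an initial segment does not depend on later interventions. -/
lemma SWIGLocalMarkov.pr_agree_congr (hpa : ∀ i, pa i ⊆ pre i)
    (hP : ∀ f, suppIn f A → IsProb (P f)) (hM : SWIGLocalMarkov A pa P)
    {S : Finset V} (hS : IsLowerSet (S : Set V)) {a a' : ∀ j, 𝔛 j}
    (ha : ∀ j ∈ S, a j = a' j) (w : ∀ j, 𝔛 j) :
    pr (P (setOn A a)) (agree S w) = pr (P (setOn A a')) (agree S w) := by
  induction S, hS using lowerSet_induction with
  | empty => simp_rw [pr_agree_empty (hP _ (suppIn_setOn subset_rfl _))]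
  | insert i ih =>
    have ha' : ∀ j ∈ pre i, a j = a' j := fun j hj => ha j (mem_insert_of_mem hj)
    simp_rw [pr_congr _ (agree_insert_iff i (pre i) w)]
    exact hM.pr_and_congr hpa hP i w (w i) ha' (ih ha')

omit [∀ i, Fintype (𝔛 i)] in
lemma piecewise_update_eq_on_pre (B : Finset V) (b v : ∀ j, 𝔛 j) (i : V) (x : 𝔛 i) :
    ∀ j ∈ pre i, B.piecewise b (Function.update v i x) j = B.piecewise b v j := by
  intro j hj
  have hji : j ≠ i := fun h => notMem_pre i (h ▸ hj)
  simp [Finset.piecewise, hji]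

/-- The joint law of an initial segment under fewer interventions is the one obtained by
intervening on the remaining targets at their realized values. -/
lemma pr_agree_setOn_eq (hpa : ∀ i, pa i ⊆ pre i)
    (hP : ∀ f, suppIn f A → IsProb (P f)) (hDC : DistConsistent A P)
    (hM : SWIGLocalMarkov A pa P) {B : Finset V} (hBA : B ⊆ A) (b : ∀ j, 𝔛 j)
    {S : Finset V} (hS : IsLowerSet (S : Set V)) (v : ∀ j, 𝔛 j) :
    pr (P (setOn B b)) (agree S v) = pr (P (setOn A (B.piecewise b v))) (agree S v) := by
  induction S, hS using lowerSet_reverse_induction generalizing v with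
  | univ => rw [pr_agree_univ, pr_agree_univ, hDC.apply_eq_apply_setOn_piecewise hBA]
  | remove i ih =>
    rw [pr_eq_sum_fiber _ _ fun u => u i, pr_eq_sum_fiber _ (agree (pre i) v) fun u => u i]
    refine Finset.sum_congr rfl fun x _ => ?_
    have hx := ih (Function.update v i x)
    simp_rw [pr_congr _ (agree_insert_update_iff (notMem_pre i) v x)] at hx
    simp_rw [pr_congr _ fun u => and_comm (a := agree (pre i) v u) (b := u i = x)]
    have ha := piecewise_update_eq_on_pre B b v i x
    exact hx.trans (hM.pr_and_congr hpa hP i v x ha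
      (hM.pr_agree_congr hpa hP (isLowerSet_pre i) ha v))

lemma cpr_setOn_eq (hpa : ∀ i, pa i ⊆ pre i)
    (hP : ∀ f, suppIn f A → IsProb (P f)) (hDC : DistConsistent A P)
    (hM : SWIGLocalMarkov A pa P) {B : Finset V} (hBA : B ⊆ A) (b : ∀ j, 𝔛 j)
    (i : V) (v : ∀ j, 𝔛 j) (x : 𝔛 i) :
    cpr (P (setOn B b)) (fun u => u i = x) (agree (pre i) v)
      = cpr (P (setOn A (B.piecewise b v))) (fun u => u i = x) (agree (pre i) v) := by
  have hx := pr_agree_setOn_eq hpa hP hDC hM hBA b (isLowerSet_insert_pre i)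
    (Function.update v i x)
  simp_rw [pr_congr _ (agree_insert_update_iff (notMem_pre i) v x)] at hx
  have ha := piecewise_update_eq_on_pre B b v i x
  rw [cpr, cpr, pr_agree_setOn_eq hpa hP hDC hM hBA b (isLowerSet_pre i) v, hx,
    hM.pr_and_congr hpa hP i v x ha (hM.pr_agree_congr hpa hP (isLowerSet_pre i) ha v)]

/-- The interventional conditional distributions equal the observed ones given the parents. -/
lemma cpr_setOn_eq_cpr_observed (hpa : ∀ i, pa i ⊆ pre i)
    (hP : ∀ f, suppIn f A → IsProb (P f)) (hDC : DistConsistent A P)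
    (hM : SWIGLocalMarkov A pa P) {B : Finset V} (hBA : B ⊆ A) (b : ∀ j, 𝔛 j)
    (i : V) (v : ∀ j, 𝔛 j) (hpos : 0 < pr (P (setOn B b)) (agree (pre i) v))
    (hobs : 0 < pr (P (fun _ => none))
      (fun u => agree (pa i ∩ B) b u ∧ agree (pa i \ B) v u)) :
    cpr (P (setOn B b)) (fun u => u i = v i) (agree (pre i) v)
      = cpr (P (fun _ => none)) (fun u => u i = v i)
          (fun u => agree (pa i ∩ B) b u ∧ agree (pa i \ B) v u) := by
  rw [← setOn_empty b] at hobs ⊢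
  have hq := (hP (setOn ∅ b) (suppIn_setOn (empty_subset A) b)).1
  refine Eq.symm ((div_eq_iff hobs.ne').2 ?_)
  refine pr_and_eq_mul_of_fiberwise _ _ _ (pre i) _ (fun u w huw => and_congr ?_ ?_) ?_
  · exact forall₂_congr fun j hj => by rw [huw j (hpa i (mem_inter.1 hj).1)]
  · exact forall₂_congr fun j hj => by rw [huw j (hpa i (mem_sdiff.1 hj).1)]
  rintro w ⟨hwB, hwv⟩
  rw [pr_and_eq_cpr_mul hq]
  rcases (pr_nonneg hq (agree (pre i) w)).eq_or_lt with h0 | h0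
  · rw [← h0, mul_zero, mul_zero]
  congr 1
  rw [cpr_setOn_eq hpa hP hDC hM hBA, cpr_setOn_eq hpa hP hDC hM (empty_subset A)]
  rw [pr_agree_setOn_eq hpa hP hDC hM hBA b (isLowerSet_pre i)] at hpos
  rw [pr_agree_setOn_eq hpa hP hDC hM (empty_subset A) b (isLowerSet_pre i)] at h0
  refine hM i _ _ w v (v i) h0 hpos (fun j hj => ?_) fun j hj => ?_
  · have hj := (mem_inter.1 hj).1
    rw [piecewise_empty]
    by_cases hjB : j ∈ B
    · rw [B.piecewise_eq_of_mem b v hjB, hwB j (mem_inter.2 ⟨hj, hjB⟩)]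
    · rw [B.piecewise_eq_of_notMem b v hjB, hwv j (mem_sdiff.2 ⟨hj, hjB⟩)]
  · obtain ⟨hj, hjA⟩ := mem_sdiff.1 hj
    exact hwv j (mem_sdiff.2 ⟨hj, fun hjB => hjA (hBA hjB)⟩)

end Interventions

/-- Theorem 3: interventions on a subset `B ⊆ A`; the interventional conditionals
equal the corresponding observed conditionals, and `p(V(b))` is identified by the
corresponding g-formula whenever the observed conditionals are well-defined. -/
theorem stmt8_fewer_interventions
    (A : Finset V) (hA : A ⊆ univ)
    (pa : V → Finset V) (hpa : ∀ i, pa i ⊆ pre i)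
    (P : (∀ i, Option (𝔛 i)) → (∀ i, 𝔛 i) → ℝ)
    (hP : ∀ f, suppIn f A → IsProb (P f))
    (hDC : DistConsistent A P)
    (hM : SWIGLocalMarkov A pa P)
    (B : Finset V) (hBA : B ⊆ A) (b : ∀ j, 𝔛 j) :
    (∀ (i : V) (v : ∀ j, 𝔛 j),
      0 < pr (P (setOn B b)) (agree (pre i) v) →
      0 < pr (P (fun _ => none))
            (fun u => agree (pa i ∩ B) b u ∧ agree (pa i \ B) v u) →
      cpr (P (setOn B b)) (fun u => u i = v i) (agree (pre i) v)
        = cpr (P (fun _ => none)) (fun u => u i = v i)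
            (fun u => agree (pa i ∩ B) b u ∧ agree (pa i \ B) v u)) ∧
    (∀ v : ∀ j, 𝔛 j,
      (∀ i : V, 0 < pr (P (fun _ => none))
          (fun u => agree (pa i ∩ B) b u ∧ agree (pa i \ B) v u)) →
      P (setOn B b) v
        = ∏ i : V, cpr (P (fun _ => none)) (fun u => u i = v i)
            (fun u => agree (pa i ∩ B) b u ∧ agree (pa i \ B) v u)) := by
  have hcond := fun i v => cpr_setOn_eq_cpr_observed hpa hP hDC hM hBA b i v
  refine ⟨hcond, fun v hobs => ?_⟩
  have hprob := hP (setOn B b) (suppIn_setOn hBA b)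
  rw [← pr_agree_univ (P (setOn B b)) v]
  have huniv : IsLowerSet ((univ : Finset V) : Set V) := by simpa using isLowerSet_univ
  generalize (univ : Finset V) = S at huniv ⊢
  induction S, huniv using lowerSet_induction with
  | empty => rw [pr_agree_empty hprob, prod_empty]
  | insert i ih =>
    rw [prod_insert (notMem_pre i), ← ih, pr_congr _ (agree_insert_iff i (pre i) v),
      pr_and_eq_cpr_mul hprob.1]
    rcases (pr_nonneg hprob.1 (agree (pre i) v)).eq_or_lt with h0 | h0
    · rw [← h0, mul_zero, mul_zero]
    · rw [hcond i v h0 (hobs i)]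

end CausalPaper
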